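/- arXiv:2510.07635 — 2 statements merged into one kernel-verified Lean document; each statement's English description precedes it below -/
import Mathlib

section
/- Let 𝒳 and 𝒜 be finite sets, p a probability mass function on 𝒳, let π and π₀ be policies, and let τ ≥ 0. Since q is nonnegative, the expectation of the clipped importance-weighted reward under the logging policy never exceeds the policy value of π: Σ_{x∈𝒳} p(x) Σ_{a : π₀(a|x) > 0} π₀(a|x) · min(π(a|x)/π₀(a|x), τ) · q(x,a) ≤ V(π). This holds even when π₀ has deficient support, i.e., even if some actions a with π(a|x) > 0 satisfy π₀(a|x) = 0. -/
open Finset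

/-- Since `q` is nonnegative, the clipped importance-weighted
expectation never exceeds the policy value of `π`, even under deficient support. -/
theorem clipped_ips_le_value
    {X A : Type*} [Fintype X] [Fintype A]
    (p : X → ℝ) (hp : ∀ x, 0 ≤ p x) (hp1 : ∑ x, p x = 1)
    (π π₀ : X → A → ℝ)
    (hπ : ∀ x a, 0 ≤ π x a) (hπ1 : ∀ x, ∑ a, π x a = 1)
    (hπ₀ : ∀ x a, 0 ≤ π₀ x a) (hπ₀1 : ∀ x, ∑ a, π₀ x a = 1)
    (q : X → A → ℝ) (r_max : ℝ)
    (hq : ∀ x a, 0 ≤ q x a) (hq' : ∀ x a, q x a ≤ r_max)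
    (τ : ℝ) (hτ : 0 ≤ τ) :
    ∑ x, p x * ∑ a ∈ univ.filter (fun a => 0 < π₀ x a),
        π₀ x a * min (π x a / π₀ x a) τ * q x a
      ≤ ∑ x, p x * ∑ a, π x a * q x a := by
  refine sum_le_sum fun x _ => mul_le_mul_of_nonneg_left ?_ (hp x)
  refine (sum_le_sum fun a ha => ?_).trans
    (sum_le_sum_of_subset_of_nonneg (filter_subset _ _) fun a _ _ => mul_nonneg (hπ x a) (hq x a))
  have h₀ : 0 < π₀ x a := (mem_filter.mp ha).2
  refine mul_le_mul_of_nonneg_right ?_ (hq x a)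
  calc π₀ x a * min (π x a / π₀ x a) τ
      ≤ π₀ x a * (π x a / π₀ x a) := mul_le_mul_of_nonneg_left (min_le_left _ _) h₀.le
    _ = π x a := mul_div_cancel₀ _ h₀.ne'
end

section
/- Let 𝒳 and 𝒜 be finite sets, p a probability mass function on 𝒳, let π and π₀ be policies, and let τ ≥ 0. The downward bias of the clipped importance-weighted expectation is bounded by the clipped-away probability mass times r_max: V(π) − Σ_{x∈𝒳} p(x) Σ_{a : π₀(a|x) > 0} π₀(a|x) · min(π(a|x)/π₀(a|x), τ) · q(x,a) ≤ r_max · Σ_{x∈𝒳} p(x) Σ_{a∈𝒜} max(π(a|x) − τ·π₀(a|x), 0). -/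
open Finset

/-- Truncating an importance weight at `τ` removes exactly the mass `max (w - τ * v) 0`. -/
theorem sub_mul_min_div_eq_max {w v : ℝ} (hv : 0 < v) (τ : ℝ) :
    w - v * min (w / v) τ = max (w - τ * v) 0 := by
  rw [mul_min_of_nonneg _ _ hv.le, mul_div_cancel₀ _ hv.ne', mul_comm v τ]
  rcases le_total w (τ * v) with h | h
  · rw [min_eq_left h, max_eq_right (by linarith), sub_self]
  · rw [min_eq_right h, max_eq_left (by linarith)]

/-- The downward bias of the clipped importance-weighted
expectation is bounded by the clipped-away probability mass times `r_max`. -/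
theorem clipped_ips_bias_bound
    {X A : Type*} [Fintype X] [Fintype A]
    (p : X → ℝ) (hp : ∀ x, 0 ≤ p x) (hp1 : ∑ x, p x = 1)
    (π π₀ : X → A → ℝ)
    (hπ : ∀ x a, 0 ≤ π x a) (hπ1 : ∀ x, ∑ a, π x a = 1)
    (hπ₀ : ∀ x a, 0 ≤ π₀ x a) (hπ₀1 : ∀ x, ∑ a, π₀ x a = 1)
    (q : X → A → ℝ) (r_max : ℝ)
    (hq : ∀ x a, 0 ≤ q x a) (hq' : ∀ x a, q x a ≤ r_max)
    (τ : ℝ) (hτ : 0 ≤ τ) :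
    (∑ x, p x * ∑ a, π x a * q x a)
      - ∑ x, p x * ∑ a ∈ univ.filter (fun a => 0 < π₀ x a),
          π₀ x a * min (π x a / π₀ x a) τ * q x a
      ≤ r_max * ∑ x, p x * ∑ a, max (π x a - τ * π₀ x a) 0 := by
  rw [← sum_sub_distrib, mul_sum]
  refine sum_le_sum fun x _ => ?_
  rw [← mul_sub, mul_left_comm]
  refine mul_le_mul_of_nonneg_left ?_ (hp x)
  rw [sum_filter, ← sum_sub_distrib, mul_sum]
  refine sum_le_sum fun a _ => ?_
  split_ifs with h
  · rw [← sub_mul, sub_mul_min_div_eq_max h, mul_comm]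
    exact mul_le_mul_of_nonneg_right (hq' x a) (le_max_right _ _)
  · rw [le_antisymm (not_lt.mp h) (hπ₀ x a), mul_zero, sub_zero, sub_zero,
      max_eq_left (hπ x a), mul_comm]
    exact mul_le_mul_of_nonneg_right (hq' x a) (hπ x a)
end
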